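/- Let 0 ≤ m ≤ n and let S_1, …, S_n be m-element subsets of [n] forming a Grassmann necklace, i.e., with indices taken modulo n (so S_{n+1} = S_1), one has S_{i+1} − S_i = {i} for every i ∈ [n]. Then the sets S_1, …, S_n are pairwise weakly separated. -/

import Mathlib

open Finset

/-- max of a finite set of naturals, with the convention `max0 ∅ = 0`. -/
def max0 (A : Finset ℕ) : ℕ := if h : A.Nonempty then A.max' h else 0

/-- min of a finite set of naturals, with the convention `min0 ∅ = 0`. -/
def min0 (A : Finset ℕ) : ℕ := if h : A.Nonempty then A.min' h else 0

/-- `A < B` : global dominating, i.e. `max A < min B` (with `min ∅ = max ∅ = 0`). -/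
def SetLT (A B : Finset ℕ) : Prop := max0 A < min0 B

/-- `A ⋖ B` : global dominating after cancelations, i.e. `(A − B) < (B − A)`. -/
def LessDot (A B : Finset ℕ) : Prop := SetLT (A \ B) (B \ A)

/-- `A ▷ B` (splitting): `A − B ≠ ∅` and `B − A` is a union of nonempty subsets
`B′, B″` with `B′ < (A − B) < B″`. -/
def Splits (A B : Finset ℕ) : Prop :=
  (A \ B).Nonempty ∧ ∃ B' B'' : Finset ℕ, B'.Nonempty ∧ B''.Nonempty ∧
    B' ∪ B'' = B \ A ∧ SetLT B' (A \ B) ∧ SetLT (A \ B) B''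

/-- `A` and `B` are strongly separated. -/
def StronglySep (A B : Finset ℕ) : Prop := LessDot A B ∨ LessDot B A ∨ A = B

/-- `A` and `B` are weakly separated. -/
def WeaklySep (A B : Finset ℕ) : Prop :=
  StronglySep A B ∨ (Splits A B ∧ B.card ≤ A.card) ∨ (Splits B A ∧ A.card ≤ B.card)

/-- a w-collection: members are pairwise weakly separated. -/
def IsWColl (F : Finset (Finset ℕ)) : Prop := ∀ A ∈ F, ∀ B ∈ F, WeaklySep A B

/-- a maximal w-collection in the domain `D`. -/
def IsMaxWColl (D : Set (Finset ℕ)) (F : Finset (Finset ℕ)) : Prop :=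
  ↑F ⊆ D ∧ IsWColl F ∧
    ∀ G : Finset (Finset ℕ), ↑G ⊆ D → IsWColl G → F ⊆ G → F = G

/-- the domain `D` is w-pure: all maximal w-collections in `D` have the same cardinality. -/
def WPure (D : Set (Finset ℕ)) : Prop :=
  ∀ F G : Finset (Finset ℕ), IsMaxWColl D F → IsMaxWColl D G → F.card = G.card

/-- an s-collection: members are pairwise strongly separated. -/
def IsSColl (F : Finset (Finset ℕ)) : Prop := ∀ A ∈ F, ∀ B ∈ F, StronglySep A B

/-- a maximal s-collection in the domain `D`. -/
def IsMaxSColl (D : Set (Finset ℕ)) (F : Finset (Finset ℕ)) : Prop :=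
  ↑F ⊆ D ∧ IsSColl F ∧
    ∀ G : Finset (Finset ℕ), ↑G ⊆ D → IsSColl G → F ⊆ G → F = G

/-- the domain `D` is s-pure: all maximal s-collections in `D` have the same cardinality. -/
def SPure (D : Set (Finset ℕ)) : Prop :=
  ∀ F G : Finset (Finset ℕ), IsMaxSColl D F → IsMaxSColl D G → F.card = G.card

theorem SetLT.of_forall_lt {X Y : Finset ℕ} (hX : X.Nonempty) (hY : Y.Nonempty)
    (h : ∀ x ∈ X, ∀ y ∈ Y, x < y) : SetLT X Y := by
  simpa only [SetLT, max0, min0, dif_pos hX, dif_pos hY] using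
    h _ (X.max'_mem hX) _ (Y.min'_mem hY)

theorem StronglySep.symm {A B : Finset ℕ} (h : StronglySep A B) : StronglySep B A := by
  rcases h with h | h | h
  · exact Or.inr (Or.inl h)
  · exact Or.inl h
  · exact Or.inr (Or.inr h.symm)

theorem WeaklySep.symm {A B : Finset ℕ} (h : WeaklySep A B) : WeaklySep B A := by
  rcases h with h | h | h
  · exact Or.inl h.symm
  · exact Or.inr (Or.inr h)
  · exact Or.inr (Or.inl h)

theorem sdiff_subset_Ico_of_step {n : ℕ} {S : ℕ → Finset ℕ}
    (hstep : ∀ i ∈ Finset.Icc 1 n, S (i + 1) \ S i = {i}) {a b : ℕ} (ha : 1 ≤ a) (hab : a ≤ b)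
    (hb : b ≤ n + 1) : S b \ S a ⊆ Finset.Ico a b := by
  induction b, hab using Nat.le_induction with
  | base => simp
  | succ b hab ih =>
    intro x hx
    rw [Finset.mem_sdiff] at hx
    rw [Finset.mem_Ico]
    by_cases hxb : x ∈ S b
    · have := Finset.mem_Ico.1 (ih (by lia) (Finset.mem_sdiff.2 ⟨hxb, hx.2⟩))
      lia
    · have h := Finset.mem_sdiff.2 ⟨hx.1, hxb⟩
      rw [hstep b (Finset.mem_Icc.2 ⟨by lia, by lia⟩), Finset.mem_singleton] at h
      lia

/-- Sets of equal size are weakly separated if one difference lies in an interval `[p, q)` and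
the other one lies outside it. -/
theorem WeaklySep.of_sdiff_Ico {A B : Finset ℕ} {p q : ℕ} (hcard : A.card = B.card)
    (hBA : ∀ x ∈ B \ A, p ≤ x ∧ x < q) (hAB : ∀ x ∈ A \ B, x < p ∨ q ≤ x) :
    WeaklySep A B := by
  by_cases hEq : A = B
  · exact Or.inl (Or.inr (Or.inr hEq))
  have hA : (A \ B).Nonempty := by
    rw [Finset.sdiff_nonempty]
    exact fun h => hEq (Finset.eq_of_subset_of_card_le h hcard.ge)
  have hB : (B \ A).Nonempty := by
    rw [Finset.sdiff_nonempty]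
    exact fun h => hEq (Finset.eq_of_subset_of_card_le h hcard.le).symm
  by_cases hlow : ∀ x ∈ A \ B, q ≤ x
  · exact Or.inl (Or.inr (Or.inl (SetLT.of_forall_lt hB hA
      fun x hx y hy => (hBA x hx).2.trans_le (hlow y hy))))
  by_cases hhigh : ∀ x ∈ A \ B, x < p
  · exact Or.inl (Or.inl (SetLT.of_forall_lt hA hB
      fun x hx y hy => (hhigh x hx).trans_le (hBA y hy).1))
  push Not at hlow hhigh
  obtain ⟨u, hu, huq⟩ := hlow
  obtain ⟨v, hv, hvp⟩ := hhigh
  have hB' : ((A \ B).filter (· < p)).Nonempty :=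
    ⟨u, Finset.mem_filter.2 ⟨hu, (hAB u hu).resolve_right (by lia)⟩⟩
  have hB'' : ((A \ B).filter (¬ · < p)).Nonempty :=
    ⟨v, Finset.mem_filter.2 ⟨hv, by lia⟩⟩
  refine Or.inr (Or.inr ⟨⟨hB, _, _, hB', hB'', Finset.filter_union_filter_not_eq _ _,
    SetLT.of_forall_lt hB' hB fun x hx y hy => ?_,
    SetLT.of_forall_lt hB hB'' fun x hx y hy => ?_⟩, hcard.le⟩)
  · exact (Finset.mem_filter.1 hx).2.trans_le (hBA y hy).1
  · rw [Finset.mem_filter] at hy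
    exact (hBA x hx).2.trans_le ((hAB y hy.1).resolve_left hy.2)

/-- the members of a Grassmann necklace are pairwise weakly
separated. -/
theorem grassmann_necklace_weaklySep (n m : ℕ) (hn : 1 ≤ n) (hm : m ≤ n)
    (S : ℕ → Finset ℕ)
    (hsub : ∀ i ∈ Finset.Icc 1 n, S i ⊆ Finset.Icc 1 n)
    (hcard : ∀ i ∈ Finset.Icc 1 n, (S i).card = m)
    (hcyc : S (n + 1) = S 1)
    (hstep : ∀ i ∈ Finset.Icc 1 n, S (i + 1) \ S i = {i}) :
    ∀ p ∈ Finset.Icc 1 n, ∀ q ∈ Finset.Icc 1 n, WeaklySep (S p) (S q) := by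
  intro p hp q hq
  wlog hpq : p ≤ q generalizing p q
  · exact (this q hq p hp (by lia)).symm
  have hp' := Finset.mem_Icc.1 hp
  have hq' := Finset.mem_Icc.1 hq
  refine WeaklySep.of_sdiff_Ico (p := p) (q := q) ((hcard p hp).trans (hcard q hq).symm)
    (fun x hx => Finset.mem_Ico.1
      (sdiff_subset_Ico_of_step hstep hp'.1 hpq (by lia) hx)) fun x hx => ?_
  rw [Finset.mem_sdiff] at hx
  by_cases hx1 : x ∈ S 1
  · exact Or.inr (Finset.mem_Ico.1 (sdiff_subset_Ico_of_step hstep hq'.1 (by lia) le_rfl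
      (Finset.mem_sdiff.2 ⟨hcyc ▸ hx1, hx.2⟩))).1
  · exact Or.inl (Finset.mem_Ico.1 (sdiff_subset_Ico_of_step hstep le_rfl hp'.1 (by lia)
      (Finset.mem_sdiff.2 ⟨hx.1, hx1⟩))).2
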